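/- Let θ be κ-multiplicatively approximable with κ > 0 and φ ∈ 𝔖(ℝ^d). Then the lattice sum S(Λ_θ, φ, u, T) = Σ_{x ∈ Λ_θ^♮} e^{2πi u·x}/(x₁⋯x_d) · φ(T^{−1}x) satisfies sup_{u ∈ ℝ^d} |S(Λ_θ, φ, u, T)| = O(T^κ (log T)^{d-1}) as T → ∞. -/

import Mathlib

open scoped BigOperators Real

/-- Distance from a real number to the nearest integer. -/
noncomputable def distInt (x : ℝ) : ℝ := |x - round x|

/-- The term of the lattice sum `S(Λ_θ, φ, u, T)`: for the lattice point
`x = (θ₁ m_d - m₁, …, θ_{d-1} m_d - m_{d-1}, m_d)` with `m_d ≠ 0`,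
`e^{2πi u·x}/(x₁⋯x_d) · φ(T^{-1} x)` (terms with `m_d = 0` are set to `0`). -/
noncomputable def latticeTerm (n : ℕ) (θ : Fin n → ℝ)
    (φ : SchwartzMap (Fin (n + 1) → ℝ) ℝ) (u : Fin (n + 1) → ℝ) (T : ℝ)
    (p : (Fin n → ℤ) × ℤ) : ℂ :=
  if p.2 = 0 then 0 else
    Complex.exp (2 * π * Complex.I *
        (((∑ j, u j.castSucc * (θ j * (p.2 : ℝ) - (p.1 j : ℝ))) +
          u (Fin.last n) * (p.2 : ℝ)) : ℝ)) /
      (((∏ j, (θ j * (p.2 : ℝ) - (p.1 j : ℝ))) * (p.2 : ℝ) : ℝ) : ℂ) *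
    ((φ (T⁻¹ • (Fin.snoc (fun j => θ j * (p.2 : ℝ) - (p.1 j : ℝ)) (p.2 : ℝ) :
        Fin (n + 1) → ℝ)) : ℝ) : ℂ)

lemma distInt_le (y : ℝ) (k : ℤ) : distInt y ≤ |y - k| := round_le y k

lemma distInt_le_half (y : ℝ) : distInt y ≤ 1/2 := abs_sub_round y

lemma distInt_neg (y : ℝ) : distInt (-y) = distInt y := by
  have h : ∀ z : ℝ, distInt (-z) ≤ distInt z := fun z => by
    refine (distInt_le (-z) (-(round z))).trans ?_
    rw [distInt, abs_sub_comm]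
    push_cast
    apply le_of_eq
    congr 1; ring
  apply le_antisymm (h y)
  simpa using h (-y)

lemma int_sum_le (U : Finset ℤ) (f : ℕ → ℝ) (hf : ∀ i, 0 ≤ f i) (B : ℝ)
    (hB : ∀ K, ∑ i ∈ Finset.range K, f i ≤ B) : ∑ k ∈ U, f k.natAbs ≤ 2 * B := by
  have key : ∀ V : Finset ℤ, Set.InjOn Int.natAbs (V : Set ℤ) → ∑ k ∈ V, f k.natAbs ≤ B := by
    intro V hV
    rw [← Finset.sum_image (f := f) hV]
    refine le_trans ?_ (hB ((V.image Int.natAbs).sup id + 1))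
    apply Finset.sum_le_sum_of_subset_of_nonneg
    · intro i hi
      rw [Finset.mem_range, Nat.lt_succ_iff]
      exact Finset.le_sup (f := id) hi
    · intros; apply hf
  rw [← Finset.sum_filter_add_sum_filter_not U (fun k => 0 ≤ k)]
  have h1 := key (U.filter (fun k => 0 ≤ k)) (by
    intro a ha b hb h
    simp at ha hb
    omega)
  have h2 := key (U.filter (fun k => ¬ 0 ≤ k)) (by
    intro a ha b hb h
    simp at ha hb
    omega)
  linarith

lemma log_ge (T : ℝ) (hT : 2 ≤ T) : 1/2 ≤ Real.log T := by
  have := Real.log_two_gt_d9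
  have := Real.log_le_log (by norm_num) hT
  linarith

lemma tele (S K : ℕ) : ∑ i ∈ Finset.range K, ((1:ℝ)/(i+1) - 1/(i+1+S)) ≤ ∑ i ∈ Finset.range S, (1:ℝ)/(i+1) := by
  have h := Finset.sum_range_add (fun i : ℕ => (1:ℝ)/(i+1)) S K
  have h' : ∑ i ∈ Finset.range K, (1:ℝ)/(i+1) ≤ ∑ i ∈ Finset.range (S+K), (1:ℝ)/(i+1) := by
    apply Finset.sum_le_sum_of_subset_of_nonneg
    · intro i; simp; omega
    · intros; positivity
  rw [Finset.sum_sub_distrib]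
  have h2 : ∑ i ∈ Finset.range K, (1:ℝ)/(i+1+S) = ∑ i ∈ Finset.range K, (1:ℝ)/(((S+i:ℕ):ℝ)+1) := by
    apply Finset.sum_congr rfl
    intro i _
    push_cast; congr 1; ring
  rw [h2]; linarith

lemma inner_sum_le (T : ℝ) (hT : 2 ≤ T) (y : ℝ) (hy : 0 < distInt y) (U : Finset ℤ) :
    ∑ k ∈ U, 1/(|y-k| * (1+|y-k|/T)) ≤ 1/distInt y + 20 * Real.log T := by
  obtain ⟨S, hS⟩ : ∃ S : ℕ, S = ⌈2*T⌉₊ := ⟨_, rfl⟩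
  have hS1 : 2*T ≤ S := by rw [hS]; exact Nat.le_ceil _
  have hS2 : (S:ℝ) < 2*T+1 := by rw [hS]; exact Nat.ceil_lt_add_one (by linarith)
  set f : ℕ → ℝ := fun i => if i = 0 then 0 else 2 * (1/(i:ℝ) - 1/(i+S)) with hf
  have hf0 : ∀ i, 0 ≤ f i := by
    intro i
    simp only [hf]
    split_ifs with h
    · rfl
    · have : (0:ℝ) < i := by exact_mod_cast Nat.pos_of_ne_zero h
      have : (1:ℝ)/(i+S) ≤ 1/i := one_div_le_one_div_of_le this (by linarith)
      linarith
  have hlog := log_ge T hT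
  have hH : ∑ i ∈ Finset.range S, (1:ℝ)/(i+1) ≤ 5 * Real.log T := by
    have := harmonic_le_one_add_log S
    have e : ((harmonic S : ℚ) : ℝ) = ∑ i ∈ Finset.range S, (1:ℝ)/(i+1) := by
      simp [harmonic]
    rw [e] at this
    have h2 : Real.log S ≤ Real.log (T^3) := by
      apply Real.log_le_log (by linarith)
      have e3 : 4 * T ≤ T^3 := by
        have : 0 ≤ T * ((T-2)*(T+2)) := by
          apply mul_nonneg (by linarith) (mul_nonneg (by linarith) (by linarith))
        nlinarith
      linarith
    rw [Real.log_pow] at h2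
    push_cast at h2
    linarith
  have hB : ∀ K, ∑ i ∈ Finset.range K, f i ≤ 10 * Real.log T := by
    intro K
    have h1 : ∑ i ∈ Finset.range K, f i ≤ ∑ i ∈ Finset.range (K+1), f i := by
      rw [Finset.sum_range_succ]; linarith [hf0 K]
    rw [Finset.sum_range_succ'] at h1
    have h2 : ∑ i ∈ Finset.range K, f (i+1) = 2 * ∑ i ∈ Finset.range K, ((1:ℝ)/(i+1) - 1/(i+1+S)) := by
      rw [Finset.mul_sum]
      apply Finset.sum_congr rfl
      intro i _
      simp [hf]
    have h3 := tele S K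
    have h4 : f 0 = 0 := by simp [hf]
    linarith
  have hpt : ∀ k ∈ U, 1/(|y-k| * (1+|y-k|/T)) ≤ (if k = round y then 1/distInt y else 0) + f (k - round y).natAbs := by
    intro k _
    by_cases hk : k = round y
    · subst hk
      simp only [if_true]
      have : 1/(|y-round y| * (1+|y-round y|/T)) ≤ 1/distInt y := by
        apply one_div_le_one_div_of_le hy
        have : 0 ≤ |y-round y|/T := by positivity
        show |y - round y| ≤ _
        nlinarith [abs_nonneg (y - round y)]
      linarith [hf0 (round y - round y).natAbs]
    · simp only [hk, if_false, zero_add]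
      set i := (k - round y).natAbs with hi
      have hi0 : i ≠ 0 := by omega
      have hi1 : (1:ℝ) ≤ i := by exact_mod_cast Nat.one_le_iff_ne_zero.mpr hi0
      have hi2 : (i:ℝ) = |(k:ℝ) - round y| := by
        rw [hi, Nat.cast_natAbs]; push_cast; rfl
      have h3 : (i:ℝ)/2 ≤ |y - k| := by
        have a := abs_sub_round y
        have b := abs_sub_le (k:ℝ) y (round y)
        rw [abs_sub_comm (k:ℝ) y] at b
        linarith
      simp only [hf, hi0, if_false]
      have h4 : (2:ℝ) * (1/(i:ℝ) - 1/(i+S)) = 1 / ((i:ℝ)/2 * (1 + i/S)) := by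
        have : (0:ℝ) < S := by linarith
        field_simp
        ring
      rw [h4]
      have hSp : (0:ℝ) < S := by linarith
      apply one_div_le_one_div_of_le (by positivity)
      apply mul_le_mul h3 _ (by positivity) (by positivity)
      have : (i:ℝ)/S ≤ |y-k|/T := by
        rw [div_le_div_iff₀ hSp (by linarith)]
        nlinarith [abs_nonneg (y-k)]
      linarith
  refine (Finset.sum_le_sum hpt).trans ?_
  rw [Finset.sum_add_distrib]
  have h1 : ∑ k ∈ U, (if k = round y then 1/distInt y else 0) ≤ 1/distInt y := by
    rw [Finset.sum_ite_eq']
    split_ifs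
    · rfl
    · positivity
  have h2 : ∑ k ∈ U, f (k - round y).natAbs ≤ 2 * (10 * Real.log T) := by
    have := int_sum_le (U.image (fun k => k - round y)) f hf0 _ hB
    rwa [Finset.sum_image (by intro a _ b _ h; simpa using h)] at this
  linarith

lemma sep_card (S : Finset ℕ) (f : ℕ → ℝ) (b δ : ℝ) (hδ : 0 < δ) (hb : 0 ≤ b)
    (hf : ∀ m ∈ S, |f m| ≤ b) (hsep : ∀ m ∈ S, ∀ m' ∈ S, m' < m → δ ≤ |f m - f m'|) :
    (S.card : ℝ) ≤ 1 + 2 * b / δ := by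
  have hlt : ∀ m ∈ S, ∀ m' ∈ S, m' < m → ⌊(f m + b)/δ⌋₊ ≠ ⌊(f m' + b)/δ⌋₊ := by
    intro m hm m' hm' hlt heq
    have h1 := hsep m hm m' hm' hlt
    have a1 := abs_le.mp (hf m hm)
    have a2 := abs_le.mp (hf m' hm')
    have p1 : 0 ≤ (f m + b)/δ := div_nonneg (by linarith) hδ.le
    have p2 : 0 ≤ (f m' + b)/δ := div_nonneg (by linarith) hδ.le
    have u1 := Nat.floor_le p1
    have u2 := Nat.floor_le p2
    have v1 := Nat.lt_floor_add_one ((f m + b)/δ)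
    have v2 := Nat.lt_floor_add_one ((f m' + b)/δ)
    rw [heq] at u1 v1
    have h3 : |(f m + b)/δ - (f m' + b)/δ| < 1 := by
      rw [abs_lt]; constructor <;> linarith
    have h4 : (f m + b)/δ - (f m' + b)/δ = (f m - f m')/δ := by ring
    rw [h4, abs_div, abs_of_pos hδ, div_lt_one hδ] at h3
    linarith
  have hcard : S.card ≤ (Finset.range (⌊2*b/δ⌋₊ + 1)).card := by
    apply Finset.card_le_card_of_injOn (fun m => ⌊(f m + b)/δ⌋₊)
    · intro m hm
      have a1 := abs_le.mp (hf m hm)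
      simp only [Finset.coe_range, Set.mem_Iio, Nat.lt_succ_iff]
      apply Nat.floor_le_floor
      gcongr
      linarith
    · intro m hm m' hm' h
      by_contra hne
      rcases lt_or_gt_of_ne hne with h1 | h1
      · exact hlt m' hm' m hm h1 h.symm
      · exact hlt m hm m' hm' h1 h
  rw [Finset.card_range] at hcard
  have : (S.card : ℝ) ≤ ⌊2*b/δ⌋₊ + 1 := by exact_mod_cast hcard
  have := Nat.floor_le (a := 2*b/δ) (by positivity)
  linarith

lemma count_le (n : ℕ) (hn : 1 ≤ n) (θ : Fin n → ℝ) (κ c : ℝ) (hκ : 0 < κ) (hc : 0 < c)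
    (happrox : ∀ m : ℕ, 0 < m → c ≤ (m : ℝ) ^ (1 + κ) * ∏ j, distInt (θ j * m))
    (M : ℕ) (a : Fin n → ℕ) :
    (((Finset.Icc 1 M).filter (fun m : ℕ => ∀ j, distInt (θ j * m) ≤ (1/2:ℝ)^(a j))).card : ℝ)
      ≤ (1+2^n)/c * (M:ℝ)^(1+κ) * ∏ j, (1/2:ℝ)^(a j) := by
  set S := (Finset.Icc 1 M).filter (fun m : ℕ => ∀ j, distInt (θ j * m) ≤ (1/2:ℝ)^(a j)) with hS
  rcases S.eq_empty_or_nonempty with h0 | ⟨m0, hm0⟩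
  · rw [h0]; simp; positivity
  have hmem : ∀ m ∈ S, 1 ≤ m ∧ m ≤ M ∧ ∀ j, distInt (θ j * m) ≤ (1/2:ℝ)^(a j) := by
    intro m hm
    simpa [hS, and_assoc] using hm
  have hd0 : ∀ y, 0 ≤ distInt y := fun y => abs_nonneg _
  have hM1 : 1 ≤ M := (hmem m0 hm0).1.trans (hmem m0 hm0).2.1
  have hMp : (0:ℝ) < (M:ℝ)^(1+κ) := by
    apply Real.rpow_pos_of_pos; exact_mod_cast hM1
  set V := ∏ j, (1/2:ℝ)^(a j) with hV
  have hVc : c ≤ (M:ℝ)^(1+κ) * V := by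
    obtain ⟨h1, h2, h3⟩ := hmem m0 hm0
    refine (happrox m0 h1).trans ?_
    apply mul_le_mul
    · exact Real.rpow_le_rpow (by positivity) (by exact_mod_cast h2) (by linarith)
    · exact Finset.prod_le_prod (fun _ _ => hd0 _) (fun j _ => h3 j)
    · exact Finset.prod_nonneg (fun _ _ => hd0 _)
    · exact hMp.le
  set j0 : Fin n := ⟨0, hn⟩
  set Q := ∏ j ∈ Finset.univ.erase j0, (2 * (1/2:ℝ)^(a j)) with hQ
  have hQp : 0 < Q := Finset.prod_pos (fun _ _ => by positivity)
  have hQV : 2 * (1/2:ℝ)^(a j0) * Q = 2^n * V := by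
    rw [hQ, Finset.mul_prod_erase Finset.univ (fun j => 2 * (1/2:ℝ)^(a j)) (Finset.mem_univ j0),
      Finset.prod_mul_distrib]
    simp [hV]
  have hsep := sep_card S (fun m => θ j0 * m - round (θ j0 * m)) ((1/2:ℝ)^(a j0))
    (c / ((M:ℝ)^(1+κ) * Q)) (by positivity) (by positivity)
    (fun m hm => (hmem m hm).2.2 j0) (by
      intro m hm m' hm' hlt
      obtain ⟨h1, h2, h3⟩ := hmem m hm
      obtain ⟨h1', h2', h3'⟩ := hmem m' hm'
      have hdiff : ∀ j, distInt (θ j * ((m - m' : ℕ):ℝ)) ≤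
          |(θ j * m - round (θ j * m)) - (θ j * m' - round (θ j * m'))| := by
        intro j
        refine (distInt_le _ (round (θ j * m) - round (θ j * m'))).trans (le_of_eq ?_)
        rw [Nat.cast_sub hlt.le]
        push_cast
        congr 1; ring
      have hA := happrox (m - m') (by omega)
      rw [div_le_iff₀ (by positivity)]
      refine hA.trans ?_
      rw [← Finset.mul_prod_erase Finset.univ (fun j => distInt (θ j * ((m-m':ℕ):ℝ))) (Finset.mem_univ j0)]
      have e1 : (((m-m':ℕ):ℝ))^(1+κ) ≤ (M:ℝ)^(1+κ) := by
        apply Real.rpow_le_rpow (by positivity) _ (by linarith)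
        exact_mod_cast (by omega : m - m' ≤ M)
      have e2 : ∏ j ∈ Finset.univ.erase j0, distInt (θ j * ((m-m':ℕ):ℝ)) ≤ Q := by
        apply Finset.prod_le_prod (fun _ _ => hd0 _)
        intro j _
        refine (hdiff j).trans ((abs_sub _ _).trans ?_)
        have := h3 j
        have := h3' j
        unfold distInt at *
        linarith
      have e3 := hdiff j0
      calc _ ≤ (M:ℝ)^(1+κ) * (|(θ j0 * m - round (θ j0 * m)) - (θ j0 * m' - round (θ j0 * m'))| * Q) := by
            apply mul_le_mul e1 _ _ hMp.le
            · exact mul_le_mul e3 e2 (Finset.prod_nonneg (fun _ _ => hd0 _)) (abs_nonneg _)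
            · exact mul_nonneg (hd0 _) (Finset.prod_nonneg (fun _ _ => hd0 _))
        _ = _ := by ring)
  refine hsep.trans ?_
  have e : 2 * (1/2:ℝ)^(a j0) / (c / ((M:ℝ)^(1+κ) * Q)) = 2^n * V * (M:ℝ)^(1+κ) / c := by
    rw [← hQV]; field_simp
  rw [e]
  have : 1 ≤ (M:ℝ)^(1+κ) * V / c := by rw [le_div_iff₀ hc]; linarith
  calc _ ≤ (M:ℝ)^(1+κ) * V / c + 2^n * V * (M:ℝ)^(1+κ) / c := by linarith
    _ = _ := by ring

/-- dyadic majorant -/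
lemma dyadic (δ K : ℝ) (hK : 0 ≤ K) (hδ : 0 < δ) (hδ1 : δ ≤ 1/2) (L : ℕ) (hL : 1/δ < 2^L) :
    1/δ + K ≤ ∑ a ∈ Finset.range L, (2 * 2^a + (if a = 0 then K else 0)) *
      (if δ ≤ (1/2:ℝ)^a then 1 else 0) := by
  have hex : ∃ a, ¬ (δ ≤ (1/2:ℝ)^a) := ⟨L, by
    rw [not_le, one_div_pow]
    exact (one_div_lt hδ (by positivity)).mp hL⟩
  obtain ⟨b, hb1, hb2⟩ : ∃ b, δ ≤ (1/2:ℝ)^b ∧ ¬ (δ ≤ (1/2:ℝ)^(b+1)) := by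
    classical
    have h1 := Nat.find_spec hex
    have h0 : Nat.find hex ≠ 0 := by
      intro h; rw [h] at h1; simp at h1; linarith
    obtain ⟨b, hb⟩ := Nat.exists_eq_succ_of_ne_zero h0
    refine ⟨b, ?_, ?_⟩
    · have := Nat.find_min hex (m := b) (by omega)
      simpa using this
    · rw [hb] at h1; exact h1
  have hbL : b < L := by
    by_contra h
    have h2 : (1/2:ℝ)^b ≤ (1/2)^L := pow_le_pow_of_le_one (by norm_num) (by norm_num) (by omega)
    have h3 : (1/2:ℝ)^L < δ := by
      rw [one_div_pow]; exact (one_div_lt hδ (by positivity)).mp hL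
    linarith
  have hinv : 1/δ ≤ 2 * 2^b := by
    rw [not_le] at hb2
    have := one_div_lt_one_div_of_lt (by positivity) hb2
    rw [one_div_pow, one_div_one_div, pow_succ] at this
    linarith
  have hsplit : ∑ a ∈ Finset.range L, (2 * 2^a + (if a = 0 then K else 0)) *
      (if δ ≤ (1/2:ℝ)^a then 1 else 0) = ∑ a ∈ Finset.range L, 2 * 2^a * (if δ ≤ (1/2:ℝ)^a then (1:ℝ) else 0)
      + ∑ a ∈ Finset.range L, (if a = 0 then K else 0) * (if δ ≤ (1/2:ℝ)^a then (1:ℝ) else 0) := by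
    rw [← Finset.sum_add_distrib]
    exact Finset.sum_congr rfl (fun a _ => by ring)
  rw [hsplit]
  apply add_le_add
  · refine le_trans ?_ (Finset.single_le_sum (f := fun a => 2 * 2^a * (if δ ≤ (1/2:ℝ)^a then (1:ℝ) else 0))
      (fun a _ => by positivity) (Finset.mem_range.mpr hbL))
    simp only [hb1, if_true]; linarith
  · refine le_trans ?_ (Finset.single_le_sum (f := fun a : ℕ => (if a = 0 then K else 0) * (if δ ≤ (1/2:ℝ)^a then (1:ℝ) else 0))
      (fun a _ => by positivity) (Finset.mem_range.mpr (show 0 < L by omega)))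
    have : δ ≤ 1 := by linarith
    simp [this]

lemma F_bound (n : ℕ) (hn : 1 ≤ n) (θ : Fin n → ℝ) (κ c : ℝ) (hκ : 0 < κ) (hc : 0 < c)
    (happrox : ∀ m : ℕ, 0 < m → c ≤ (m : ℝ) ^ (1 + κ) * ∏ j, distInt (θ j * m))
    (M L : ℕ) (K : ℝ) (hK : 0 ≤ K) (hL : (M:ℝ)^(1+κ)/c < 2^L) (hM : 1 ≤ M) :
    ∑ m ∈ Finset.Icc 1 M, ∏ j, (1/distInt (θ j * (m:ℝ)) + K) ≤
      (1+2^n)/c * (M:ℝ)^(1+κ) * (2 * L + K)^n := by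
  have hd0 : ∀ y, 0 ≤ distInt y := fun y => abs_nonneg _
  set w : ℕ → ℝ := fun a => 2 * 2^a + (if a = 0 then K else 0) with hw
  have hw0 : ∀ a, 0 ≤ w a := fun a => by simp only [hw]; positivity
  have h1 : ∀ m ∈ Finset.Icc 1 M, ∏ j, (1/distInt (θ j * (m:ℝ)) + K) ≤
      ∑ a ∈ Fintype.piFinset (fun _ : Fin n => Finset.range L),
        (∏ j, w (a j)) * (if ∀ j, distInt (θ j * (m:ℝ)) ≤ (1/2:ℝ)^(a j) then 1 else 0) := by
    intro m hm
    rw [Finset.mem_Icc] at hm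
    have hA := happrox m (by omega)
    have hmp : (0:ℝ) < (m:ℝ)^(1+κ) := by
      apply Real.rpow_pos_of_pos; exact_mod_cast hm.1
    have hmM : (m:ℝ)^(1+κ) ≤ (M:ℝ)^(1+κ) :=
      Real.rpow_le_rpow (by positivity) (by exact_mod_cast hm.2) (by linarith)
    have hle : ∀ j, c ≤ (m:ℝ)^(1+κ) * distInt (θ j * m) := by
      intro j
      refine hA.trans ?_
      apply mul_le_mul_of_nonneg_left _ hmp.le
      rw [← Finset.mul_prod_erase Finset.univ (fun j => distInt (θ j * (m:ℝ))) (Finset.mem_univ j)]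
      apply mul_le_of_le_one_right (hd0 _)
      apply Finset.prod_le_one (fun _ _ => hd0 _)
      intro i _
      linarith [distInt_le_half (θ i * m)]
    have hpos : ∀ j, 0 < distInt (θ j * m) := by
      intro j
      by_contra h
      have : distInt (θ j * m) = 0 := le_antisymm (not_lt.mp h) (hd0 _)
      have := hle j
      simp_all
      linarith
    have hprod : ∏ j, (1/distInt (θ j * (m:ℝ)) + K) ≤ ∏ j, ∑ a ∈ Finset.range L, w a *
      (if distInt (θ j * (m:ℝ)) ≤ (1/2:ℝ)^a then 1 else 0) := by
      apply Finset.prod_le_prod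
      · intro j _
        have := hpos j
        positivity
      · intro j _
        apply dyadic _ K hK (hpos j) (distInt_le_half _) L
        refine lt_of_le_of_lt ?_ hL
        rw [div_le_div_iff₀ (hpos j) hc]
        have := hle j
        nlinarith [hpos j]
    refine hprod.trans (le_of_eq ?_)
    rw [Finset.prod_univ_sum]
    apply Finset.sum_congr rfl
    intro a _
    rw [Finset.prod_mul_distrib]
    congr 1
    rw [Finset.prod_ite_zero]
    simp
  refine (Finset.sum_le_sum h1).trans ?_
  rw [Finset.sum_comm]
  have h2 : ∀ a ∈ Fintype.piFinset (fun _ : Fin n => Finset.range L),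
      ∑ m ∈ Finset.Icc 1 M, (∏ j, w (a j)) * (if ∀ j, distInt (θ j * (m:ℝ)) ≤ (1/2:ℝ)^(a j) then 1 else 0)
      ≤ (1+2^n)/c * (M:ℝ)^(1+κ) * ∏ j, (w (a j) * (1/2:ℝ)^(a j)) := by
    intro a _
    rw [← Finset.mul_sum, Finset.sum_boole, Finset.prod_mul_distrib]
    have := count_le n hn θ κ c hκ hc happrox M a
    calc _ ≤ (∏ j, w (a j)) * ((1+2^n)/c * (M:ℝ)^(1+κ) * ∏ j, (1/2:ℝ)^(a j)) :=
          mul_le_mul_of_nonneg_left this (Finset.prod_nonneg fun _ _ => hw0 _)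
      _ = _ := by ring
  refine (Finset.sum_le_sum h2).trans ?_
  rw [← Finset.mul_sum]
  have h3 := Finset.prod_univ_sum (fun _ : Fin n => Finset.range L) (fun (_ : Fin n) (a : ℕ) => w a * (1/2:ℝ)^a)
  rw [← h3]
  apply mul_le_mul_of_nonneg_left _ (by positivity)
  rw [Finset.prod_const, Finset.card_univ, Fintype.card_fin]
  apply pow_le_pow_left₀
  · exact Finset.sum_nonneg fun a _ => mul_nonneg (hw0 a) (by positivity)
  have h4 : ∀ a ∈ Finset.range L, w a * (1/2:ℝ)^a = 2 + (if a = 0 then K else 0) := by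
    intro a _
    have : (2:ℝ)^a * (1/2)^a = 1 := by rw [← mul_pow]; norm_num
    simp only [hw, add_mul, mul_assoc, this]
    split_ifs with h
    · simp [h]
    · simp
  rw [Finset.sum_congr rfl h4, Finset.sum_add_distrib, Finset.sum_ite_eq']
  simp only [Finset.sum_const, Finset.card_range, nsmul_eq_mul]
  split_ifs <;> linarith

lemma L_exists (κ c : ℝ) (hκ : 0 < κ) (hc : 0 < c) : ∃ C : ℝ, 0 < C ∧ ∀ T : ℝ, 2 ≤ T →
    ∀ M : ℕ, 1 ≤ M → ∃ L : ℕ, (M:ℝ)^(1+κ)/c < 2^L ∧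
      2 * (L:ℝ) + 20 * Real.log T ≤ C * (Real.log T * (1 + M/T)) := by
  refine ⟨2 * (4*(1+κ) + (2 * |Real.log c| + 1)*2) + 20, by positivity, ?_⟩
  intro T hT M hM
  have hMp : (0:ℝ) < M := by exact_mod_cast hM
  have hM1 : (1:ℝ) ≤ M := by exact_mod_cast hM
  have hl := log_ge T hT
  have hTp : 0 < T := by linarith
  set x := Real.log ((M:ℝ)^(1+κ)/c) / Real.log 2 with hx
  have hl2 := Real.log_two_gt_d9
  have hpos : 0 < (M:ℝ)^(1+κ)/c := div_pos (Real.rpow_pos_of_pos hMp _) hc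
  have hlog : Real.log ((M:ℝ)^(1+κ)/c) = (1+κ) * Real.log M - Real.log c := by
    rw [Real.log_div (Real.rpow_pos_of_pos hMp _).ne' hc.ne', Real.log_rpow hMp]
  refine ⟨⌊|x|⌋₊ + 1, ?_, ?_⟩
  · have h1 := Nat.lt_floor_add_one |x|
    have h2 : x < (⌊|x|⌋₊ + 1 : ℝ) := lt_of_le_of_lt (le_abs_self x) h1
    rw [hx, div_lt_iff₀ (by linarith)] at h2
    rw [← Real.log_lt_log_iff hpos (by positivity), Real.log_pow]
    push_cast
    exact h2
  · have h1 := Nat.floor_le (abs_nonneg x)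
    push_cast
    set X := Real.log T * (1 + M/T) with hX
    have hr : 0 ≤ (M:ℝ)/T := by positivity
    have hX1 : Real.log T ≤ X := by rw [hX]; nlinarith
    have hlogM0 : 0 ≤ Real.log M := Real.log_nonneg hM1
    have hlogM : Real.log M ≤ 2 * X := by
      have e : Real.log M = Real.log T + Real.log (M/T) := by
        rw [Real.log_div hMp.ne' hTp.ne']; ring
      have := Real.log_le_sub_one_of_pos (show 0 < (M:ℝ)/T by positivity)
      rw [hX]; nlinarith
    have hxb : |x| ≤ 2 * ((1+κ) * Real.log M + |Real.log c|) := by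
      rw [hx, hlog, abs_div, abs_of_pos (show 0 < Real.log 2 by linarith), div_le_iff₀ (by linarith)]
      have h3 : |(1+κ) * Real.log M - Real.log c| ≤ (1+κ) * Real.log M + |Real.log c| := by
        refine (abs_sub _ _).trans ?_
        rw [abs_of_nonneg (by positivity)]
      have h4 : 0 ≤ (1+κ) * Real.log M + |Real.log c| := by positivity
      nlinarith
    have h5 : (1+κ) * Real.log M ≤ (1+κ) * (2*X) := by gcongr
    have h6 : (2*|Real.log c| + 1) * 1 ≤ (2*|Real.log c| + 1) * (2 * X) := by
      gcongr; linarith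
    nlinarith

lemma geom_bound (κ : ℝ) (hκ : 0 < κ) (N : ℕ) (hN : κ + 1 ≤ N) : ∃ C : ℝ, 0 < C ∧
    ∀ T : ℝ, 2 ≤ T → ∀ K : ℕ,
    ∑ k ∈ Finset.range K, ((2:ℝ)^κ)^k / (1 + 2^k/T)^N ≤ C * T^κ := by
  set q := (2:ℝ)^κ with hq
  have hq1 : 1 < q := Real.one_lt_rpow (by norm_num) hκ
  have hq0 : 0 < q := by linarith
  refine ⟨(1/(q-1) + 2) * q, by have : 0 < q - 1 := by linarith
                                positivity, ?_⟩
  intro T hT K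
  have hTp : 0 < T := by linarith
  obtain ⟨k1, hk1, hk2⟩ : ∃ k1 : ℕ, T ≤ 2^k1 ∧ (2:ℝ)^k1 ≤ 2 * T := by
    obtain ⟨k, h1, h2⟩ := exists_nat_pow_near (show 1 ≤ T by linarith) (show (1:ℝ) < 2 by norm_num)
    exact ⟨k+1, h2.le, by rw [pow_succ]; linarith⟩
  have hqk : q^k1 ≤ q * T^κ := by
    have : q^k1 = ((2:ℝ)^k1)^κ := by
      rw [hq, ← Real.rpow_natCast, ← Real.rpow_natCast, ← Real.rpow_mul (by norm_num),
        ← Real.rpow_mul (by norm_num), mul_comm]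
    rw [this, hq, ← Real.mul_rpow (by norm_num) hTp.le]
    exact Real.rpow_le_rpow (by positivity) hk2 hκ.le
  have h0 : ∑ k ∈ Finset.range K, q^k / (1 + 2^k/T)^N ≤ ∑ k ∈ Finset.range (k1+K), q^k / (1 + 2^k/T)^N := by
    apply Finset.sum_le_sum_of_subset_of_nonneg
    · intro i; simp; omega
    · intros; positivity
  refine h0.trans ?_
  rw [Finset.sum_range_add]
  have h1 : ∑ k ∈ Finset.range k1, q^k / (1 + 2^k/T)^N ≤ q^k1 * (1/(q-1)) := by
    calc _ ≤ ∑ k ∈ Finset.range k1, q^k := by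
          apply Finset.sum_le_sum
          intro k _
          apply div_le_self (by positivity)
          apply one_le_pow₀
          have : 0 ≤ (2:ℝ)^k/T := by positivity
          linarith
      _ = (q^k1 - 1)/(q-1) := geom_sum_eq hq1.ne' _
      _ ≤ _ := by
          rw [mul_one_div]
          have : 0 < q - 1 := by linarith
          gcongr
          linarith
  have h2 : ∑ k ∈ Finset.range K, q^(k1+k) / (1 + 2^(k1+k)/T)^N ≤ q^k1 * 2 := by
    calc _ ≤ ∑ k ∈ Finset.range K, q^k1 * (1/2:ℝ)^k := by
          apply Finset.sum_le_sum
          intro k _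
          have e1 : (2:ℝ)^k ≤ 1 + 2^(k1+k)/T := by
            have : (2:ℝ)^k ≤ 2^(k1+k)/T := by
              rw [le_div_iff₀ hTp, pow_add]
              nlinarith [show (0:ℝ) < 2^k by positivity]
            linarith
          have e2 : ((2:ℝ)^k)^N ≤ (1 + 2^(k1+k)/T)^N := pow_le_pow_left₀ (by positivity) e1 N
          have e3 : 2 * q ≤ (2:ℝ)^N := by
            rw [hq, ← Real.rpow_natCast 2 N]
            calc 2 * (2:ℝ)^κ = 2^(κ+1) := by rw [Real.rpow_add (by norm_num), Real.rpow_one]; ring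
              _ ≤ _ := Real.rpow_le_rpow_of_exponent_le (by norm_num) hN
          have e4 : (2*q)^k ≤ ((2:ℝ)^k)^N := by
            rw [← pow_mul, mul_comm k N, pow_mul]
            exact pow_le_pow_left₀ (by positivity) e3 k
          calc q^(k1+k) / (1 + 2^(k1+k)/T)^N ≤ q^(k1+k)/(2*q)^k := by
                apply div_le_div_of_nonneg_left (by positivity) (by positivity) (e4.trans e2)
            _ = _ := by rw [pow_add, mul_pow, one_div_pow]; field_simp
      _ = q^k1 * ∑ k ∈ Finset.range K, (1/2:ℝ)^k := by rw [Finset.mul_sum]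
      _ ≤ _ := by
          gcongr
          exact sum_geometric_two_le K
  calc _ ≤ q^k1 * (1/(q-1)) + q^k1 * 2 := add_le_add h1 h2
    _ = q^k1 * (1/(q-1) + 2) := by ring
    _ ≤ (q * T^κ) * (1/(q-1) + 2) := by
        have : 0 < q - 1 := by linarith
        gcongr
    _ = _ := by ring

lemma dyadic_sum (f : ℕ → ℝ) (K : ℕ) : ∑ m ∈ Finset.Ico 1 (2^K), f m =
    ∑ k ∈ Finset.range K, ∑ m ∈ Finset.Ico ((2:ℕ)^k) (2^(k+1)), f m := by
  induction K with
  | zero => simp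
  | succ K ih =>
    rw [Finset.sum_range_succ, ← ih, Finset.sum_Ico_consecutive]
    · exact Nat.one_le_two_pow
    · exact Nat.pow_le_pow_right (by norm_num) (by omega)

lemma weighted_bound (n : ℕ) (hn : 1 ≤ n) (θ : Fin n → ℝ) (κ c : ℝ) (hκ : 0 < κ) (hc : 0 < c)
    (happrox : ∀ m : ℕ, 0 < m → c ≤ (m : ℝ) ^ (1 + κ) * ∏ j, distInt (θ j * m)) :
    ∃ C : ℝ, 0 < C ∧ ∃ N : ℕ, ∀ T : ℝ, 2 ≤ T → ∀ K : ℕ,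
      ∑ m ∈ Finset.Ico (1:ℕ) (2^K), 1/((m:ℝ) * (1 + m/T)^N) *
        ∏ j, (1/distInt (θ j * (m:ℝ)) + 20 * Real.log T) ≤ C * T^κ * Real.log T ^ n := by
  obtain ⟨C1, hC1, hL⟩ := L_exists κ c hκ hc
  obtain ⟨N, hN⟩ := exists_nat_ge (κ+1)
  obtain ⟨C2, hC2, hG⟩ := geom_bound κ hκ N hN
  have hd0 : ∀ y, 0 ≤ distInt y := fun y => abs_nonneg _
  set D := (1+2^n)/c * 2^(1+κ) * (C1*2)^n with hD
  have hDp : 0 < D := by positivity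
  refine ⟨D * C2, by positivity, n + N, ?_⟩
  intro T hT K
  have hTp : 0 < T := by linarith
  have hlog := log_ge T hT
  rw [dyadic_sum]
  have hblock : ∀ k ∈ Finset.range K, ∑ m ∈ Finset.Ico ((2:ℕ)^k) (2^(k+1)), 1/((m:ℝ) * (1 + m/T)^(n+N)) *
        ∏ j, (1/distInt (θ j * (m:ℝ)) + 20 * Real.log T) ≤
        D * Real.log T ^ n * (((2:ℝ)^κ)^k / (1 + 2^k/T)^N) := by
    intro k _
    have hP0 : ∀ m : ℕ, 0 ≤ ∏ j, (1/distInt (θ j * (m:ℝ)) + 20 * Real.log T) := by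
      intro m
      apply Finset.prod_nonneg
      intro j _
      have := hd0 (θ j * (m:ℝ))
      positivity
    have hkp : (0:ℝ) < 2^k := by positivity
    have hx : 0 < 1 + (2:ℝ)^k/T := by positivity
    have hM1 : 1 ≤ 2^(k+1) := Nat.one_le_two_pow
    obtain ⟨L, hL1, hL2⟩ := hL T hT (2^(k+1)) hM1
    have hF := F_bound n hn θ κ c hκ hc happrox (2^(k+1)) L (20 * Real.log T) (by positivity) hL1 hM1
    push_cast at hF hL2
    calc _ ≤ ∑ m ∈ Finset.Ico ((2:ℕ)^k) (2^(k+1)), 1/((2:ℝ)^k * (1 + 2^k/T)^(n+N)) *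
        ∏ j, (1/distInt (θ j * (m:ℝ)) + 20 * Real.log T) := by
          apply Finset.sum_le_sum
          intro m hm
          rw [Finset.mem_Ico] at hm
          have hmr : (2:ℝ)^k ≤ m := by exact_mod_cast hm.1
          apply mul_le_mul_of_nonneg_right _ (hP0 m)
          apply one_div_le_one_div_of_le (by positivity)
          gcongr
      _ = 1/((2:ℝ)^k * (1 + 2^k/T)^(n+N)) * ∑ m ∈ Finset.Ico ((2:ℕ)^k) (2^(k+1)),
        ∏ j, (1/distInt (θ j * (m:ℝ)) + 20 * Real.log T) := by rw [Finset.mul_sum]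
      _ ≤ 1/((2:ℝ)^k * (1 + 2^k/T)^(n+N)) * ∑ m ∈ Finset.Icc (1:ℕ) (2^(k+1)),
        ∏ j, (1/distInt (θ j * (m:ℝ)) + 20 * Real.log T) := by
          apply mul_le_mul_of_nonneg_left _ (by positivity)
          apply Finset.sum_le_sum_of_subset_of_nonneg
          · intro m hm
            rw [Finset.mem_Ico] at hm
            rw [Finset.mem_Icc]
            exact ⟨Nat.one_le_two_pow.trans hm.1, hm.2.le⟩
          · intro m _ _; exact hP0 m
      _ ≤ 1/((2:ℝ)^k * (1 + 2^k/T)^(n+N)) * ((1+2^n)/c * ((2:ℝ)^(k+1))^(1+κ) * (2 * L + 20 * Real.log T)^n) := by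
          apply mul_le_mul_of_nonneg_left hF (by positivity)
      _ ≤ 1/((2:ℝ)^k * (1 + 2^k/T)^(n+N)) * ((1+2^n)/c * ((2:ℝ)^(k+1))^(1+κ) *
            (C1 * (Real.log T * (2 * (1 + 2^k/T))))^n) := by
          gcongr
          refine hL2.trans ?_
          gcongr
          rw [pow_succ, mul_div_right_comm]
          linarith
      _ = _ := by
          have e : ((2:ℝ)^(k+1))^(1+κ) = 2^(1+κ) * (2^k * ((2:ℝ)^κ)^k) := by
            rw [pow_succ, Real.mul_rpow (by positivity) (by norm_num), Real.rpow_add hkp, Real.rpow_one]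
            have : ((2:ℝ)^k)^κ = ((2:ℝ)^κ)^k := by
              rw [← Real.rpow_natCast, ← Real.rpow_natCast, ← Real.rpow_mul (by norm_num),
                ← Real.rpow_mul (by norm_num), mul_comm]
            rw [this]; ring
          rw [e, hD, pow_add]
          simp only [mul_pow]
          field_simp
  refine (Finset.sum_le_sum hblock).trans ?_
  rw [← Finset.mul_sum]
  calc _ ≤ D * Real.log T ^ n * (C2 * T^κ) := by
        apply mul_le_mul_of_nonneg_left (hG T hT K) (by positivity)
    _ = _ := by ring

lemma schwartz_decay (n : ℕ) (φ : SchwartzMap (Fin (n + 1) → ℝ) ℝ) (k : ℕ) :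
    ∃ C : ℝ, 0 < C ∧ ∀ x, (1 + ‖x‖)^k * |φ x| ≤ C := by
  refine ⟨|2 ^ k * (Finset.Iic (k, 0)).sup
    (fun m : ℕ × ℕ => SchwartzMap.seminorm ℝ (E := Fin (n+1) → ℝ) (F := ℝ) m.1 m.2) φ| + 1,
    by positivity, fun x => ?_⟩
  have h := SchwartzMap.one_add_le_sup_seminorm_apply (𝕜 := ℝ) (m := (k, 0)) (k := k) (n := 0)
    le_rfl le_rfl φ x
  rw [norm_iteratedFDeriv_zero, Real.norm_eq_abs] at h
  exact h.trans ((le_abs_self _).trans (by simp))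

/-- If `θ` is `κ`-multiplicatively approximable (`κ > 0`) and `φ` is Schwartz, then
`sup_u |S(Λ_θ, φ, u, T)| = O(T^κ (log T)^{d-1})`. -/
theorem main_lattice_sum_bound (n : ℕ) (hn : 1 ≤ n) (θ : Fin n → ℝ)
    (hθ : ∀ j, Irrational (θ j)) (κ c : ℝ) (hκ : 0 < κ) (hc : 0 < c)
    (happrox : ∀ m : ℕ, 0 < m → c ≤ (m : ℝ) ^ (1 + κ) * ∏ j, distInt (θ j * m))
    (φ : SchwartzMap (Fin (n + 1) → ℝ) ℝ) :
    ∃ C : ℝ, 0 < C ∧ ∀ T : ℝ, 2 ≤ T → ∀ u : Fin (n + 1) → ℝ,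
      ‖∑' p : (Fin n → ℤ) × ℤ, latticeTerm n θ φ u T p‖
        ≤ C * T ^ κ * Real.log T ^ n := by
  have hd0 : ∀ y, 0 ≤ distInt y := fun y => abs_nonneg _
  obtain ⟨C1, hC1, N, hW⟩ := weighted_bound n hn θ κ c hκ hc happrox
  obtain ⟨C0, hC0, hφ⟩ := schwartz_decay n φ (n + N)
  refine ⟨2 * C0 * C1, by positivity, ?_⟩
  intro T hT u
  have hTp : 0 < T := by linarith
  have hlog := log_ge T hT
  have hpos : ∀ (m : ℤ) (j : Fin n), m ≠ 0 → 0 < distInt (θ j * m) ∧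
      distInt (θ j * m) = distInt (θ j * (m.natAbs : ℝ)) := by
    intro m j hm
    have h2 : distInt (θ j * m) = distInt (θ j * (m.natAbs : ℝ)) := by
      rcases Int.natAbs_eq m with h | h
      · have : (m:ℝ) = (m.natAbs : ℝ) := by
          have h' := congrArg (fun z : ℤ => (z:ℝ)) h
          simpa only [Int.cast_neg, Int.cast_natCast] using h'
        rw [← this]
      · have : (m:ℝ) = -(m.natAbs : ℝ) := by
          have h' := congrArg (fun z : ℤ => (z:ℝ)) h
          simpa only [Int.cast_neg, Int.cast_natCast] using h'
        rw [this, mul_neg, distInt_neg]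
    refine ⟨?_, h2⟩
    rw [h2]
    have hA := happrox m.natAbs (by omega)
    by_contra h
    have h0 : distInt (θ j * (m.natAbs:ℝ)) = 0 := le_antisymm (not_lt.mp h) (hd0 _)
    rw [Finset.prod_eq_zero (Finset.mem_univ j) h0] at hA
    linarith
  set f : ℕ → ℝ := fun i => if i = 0 then 0 else 1/((i:ℝ) * (1 + i/T)^N) *
        ∏ j, (1/distInt (θ j * (i:ℝ)) + 20 * Real.log T) with hf
  have hf0 : ∀ i, 0 ≤ f i := by
    intro i
    simp only [hf]
    split_ifs
    · rfl
    · apply mul_nonneg (by positivity)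
      apply Finset.prod_nonneg
      intro j _
      have := hd0 (θ j * (i:ℝ))
      positivity
  have hfB : ∀ K, ∑ i ∈ Finset.range K, f i ≤ C1 * T^κ * Real.log T ^ n := by
    intro K
    have h1 : ∑ i ∈ Finset.range K, f i ≤ ∑ i ∈ Finset.range (2^K), f i := by
      apply Finset.sum_le_sum_of_subset_of_nonneg
      · intro i hi
        rw [Finset.mem_range] at *
        exact hi.trans Nat.lt_two_pow_self
      · intro i _ _; exact hf0 i
    refine h1.trans ?_
    rw [Finset.range_eq_Ico, Finset.sum_eq_sum_Ico_succ_bot (by positivity)]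
    have h2 : f 0 = 0 := by simp [hf]
    rw [h2, zero_add]
    refine le_trans (le_of_eq ?_) (hW T hT K)
    apply Finset.sum_congr rfl
    intro i hi
    rw [Finset.mem_Ico] at hi
    simp only [hf]
    rw [if_neg (by omega)]
  have hterm : ∀ (k : Fin n → ℤ) (m : ℤ), m ≠ 0 → ‖latticeTerm n θ φ u T (k, m)‖ ≤
      C0 * (1/((m.natAbs:ℝ) * (1 + (m.natAbs:ℝ)/T)^N)) *
        ∏ j, 1/(|θ j * m - k j| * (1 + |θ j * m - k j|/T)) := by
    intro k m hm
    have hmabs : (m.natAbs : ℝ) = |(m:ℝ)| := by rw [Nat.cast_natAbs]; push_cast; rfl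
    have hmp : 0 < |(m:ℝ)| := by positivity
    have hxp : ∀ j, 0 < |θ j * m - k j| := fun j =>
      lt_of_lt_of_le (hpos m j hm).1 (distInt_le _ _)
    rw [latticeTerm, if_neg hm]
    set y : Fin (n+1) → ℝ := T⁻¹ • (Fin.snoc (fun j => θ j * (m : ℝ) - (k j : ℝ)) (m : ℝ) :
        Fin (n + 1) → ℝ) with hy
    rw [norm_mul, norm_div]
    have e1 : ∀ r : ℝ, ‖Complex.exp (2 * π * Complex.I * (r:ℂ))‖ = 1 := by
      intro r
      have : (2 * π * Complex.I * (r:ℂ)) = ((2 * π * r : ℝ) : ℂ) * Complex.I := by push_cast; ring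
      rw [this, Complex.norm_exp_ofReal_mul_I]
    have hyl : |(m:ℝ)|/T ≤ ‖y‖ := by
      refine le_trans (le_of_eq ?_) (norm_le_pi_norm y (Fin.last n))
      simp [hy, abs_mul, abs_of_pos hTp]
      ring
    have hyj : ∀ j : Fin n, |θ j * m - k j|/T ≤ ‖y‖ := by
      intro j
      refine le_trans (le_of_eq ?_) (norm_le_pi_norm y j.castSucc)
      simp [hy, abs_mul, abs_of_pos hTp]
      ring
    have hG : (∏ j, (1 + |θ j * m - k j|/T)) * (1 + |(m:ℝ)|/T)^N ≤ (1+‖y‖)^(n+N) := by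
      rw [pow_add]
      apply mul_le_mul _ _ (by positivity) (by positivity)
      · calc _ ≤ ∏ j : Fin n, (1 + ‖y‖) := by
              apply Finset.prod_le_prod
              · intro j _; positivity
              · intro j _; linarith [hyj j]
          _ = _ := by simp
      · gcongr
    have hprodp : 0 < ∏ j, (1 + |θ j * m - k j|/T) := Finset.prod_pos fun j _ => by positivity
    have hφ2 : |φ y| ≤ C0 / ((∏ j, (1 + |θ j * m - k j|/T)) * (1 + |(m:ℝ)|/T)^N) := by
      rw [le_div_iff₀ (by positivity)]
      calc _ ≤ |φ y| * (1+‖y‖)^(n+N) := by gcongr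
        _ ≤ C0 := by rw [mul_comm]; exact hφ y
    have hxprod : 0 < ∏ j, |θ j * m - k j| := Finset.prod_pos fun j _ => hxp j
    rw [e1, Complex.norm_real, Complex.norm_real, Real.norm_eq_abs, Real.norm_eq_abs, abs_mul,
      Finset.abs_prod, hmabs]
    calc _ ≤ 1 / ((∏ j, |θ j * m - k j|) * |(m:ℝ)|) *
          (C0 / ((∏ j, (1 + |θ j * m - k j|/T)) * (1 + |(m:ℝ)|/T)^N)) := by gcongr
      _ = _ := by
          rw [Finset.prod_div_distrib, Finset.prod_mul_distrib, Finset.prod_const_one]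
          generalize (∏ j, |θ j * (m:ℝ) - k j|) = X at *
          generalize (∏ j, (1 + |θ j * (m:ℝ) - k j|/T)) = Y at *
          generalize (1 + |(m:ℝ)|/T)^N = Z at *
          generalize |(m:ℝ)| = m' at *
          simp only [one_div, div_eq_mul_inv, mul_inv]
          ring
  have hfin : ∀ s : Finset ((Fin n → ℤ) × ℤ), ∑ p ∈ s, ‖latticeTerm n θ φ u T p‖ ≤
      2 * C0 * C1 * T^κ * Real.log T ^ n := by
    intro s
    classical
    set A : Fin n → Finset ℤ := fun j => s.image (fun p => p.1 j)
    set B : Finset ℤ := s.image Prod.snd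
    have hsub : s ⊆ Fintype.piFinset A ×ˢ B := by
      intro p hp
      rw [Finset.mem_product, Fintype.mem_piFinset]
      exact ⟨fun j => Finset.mem_image_of_mem _ hp, Finset.mem_image_of_mem _ hp⟩
    have h1 : ∑ p ∈ s, ‖latticeTerm n θ φ u T p‖ ≤
        ∑ p ∈ Fintype.piFinset A ×ˢ B, ‖latticeTerm n θ φ u T p‖ :=
      Finset.sum_le_sum_of_subset_of_nonneg hsub (fun _ _ _ => norm_nonneg _)
    refine h1.trans ?_
    rw [Finset.sum_product_right]
    have h2 : ∀ m ∈ B, ∑ k ∈ Fintype.piFinset A, ‖latticeTerm n θ φ u T (k, m)‖ ≤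
        C0 * f m.natAbs := by
      intro m _
      by_cases hm : m = 0
      · subst hm
        simp [latticeTerm, hf]
      have hm' : m.natAbs ≠ 0 := by omega
      refine (Finset.sum_le_sum (fun k _ => hterm k m hm)).trans ?_
      rw [← Finset.mul_sum,
        ← Finset.prod_univ_sum A (fun j k => 1/(|θ j * m - (k:ℝ)| * (1 + |θ j * m - (k:ℝ)|/T)))]
      simp only [hf, hm', if_false]
      rw [mul_assoc]
      apply mul_le_mul_of_nonneg_left _ hC0.le
      apply mul_le_mul_of_nonneg_left _ (by positivity)
      apply Finset.prod_le_prod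
      · intro j _
        exact Finset.sum_nonneg fun k _ => by positivity
      · intro j _
        rw [← (hpos m j hm).2]
        exact inner_sum_le T hT _ (hpos m j hm).1 _
    refine (Finset.sum_le_sum h2).trans ?_
    rw [← Finset.mul_sum]
    calc _ ≤ C0 * (2 * (C1 * T^κ * Real.log T ^ n)) := by
          apply mul_le_mul_of_nonneg_left _ hC0.le
          exact int_sum_le B f hf0 _ hfB
      _ = _ := by ring
  have hsum : Summable (fun p => ‖latticeTerm n θ φ u T p‖) :=
    summable_of_sum_le (fun _ => norm_nonneg _) hfin
  exact (norm_tsum_le_tsum_norm hsum).trans (hsum.tsum_le_of_sum_le hfin)
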